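/- arXiv:1006.3367 — 4 statements merged into one kernel-verified Lean document; each statement's English description precedes it below -/
import Mathlib

section
/- Let F be a field with char F ≠ 2 and D a quaternion algebra over F. For units α, β ∈ D×, the map ρ_{α,β} : D → D defined by ρ_{α,β}(x) = α·x·β̄ is an F-linear automorphism of D which satisfies N(ρ_{α,β}(x)) = N(α)·N(β)·N(x) for all x ∈ D, and whose determinant as an F-linear endomorphism of D equals (N(α)·N(β))². Thus ρ_{α,β} is a similitude of the quadratic space (D, N) with similitude factor λ = N(α)·N(β) and determinant λ², i.e. ρ_{α,β} lies in the special similitude group GSO(D, N). -/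
open Quaternion

/-- The reduced norm of a quaternion algebra: `N x = x * x̄` viewed in `F`. -/
def quatNorm {F : Type*} [Field F] {c₁ c₂ : F} (x : ℍ[F, c₁, c₂]) : F :=
  (x * star x).re

/-- The map `x ↦ α · x · β̄` as an `F`-linear endomorphism of `D = ℍ[F,c₁,c₂]`. -/
noncomputable def rhoLinear {F : Type*} [Field F] {c₁ c₂ : F} (α β : ℍ[F, c₁, c₂]) :
    ℍ[F, c₁, c₂] →ₗ[F] ℍ[F, c₁, c₂] where
  toFun x := α * x * star β
  map_add' x y := by noncomm_ring
  map_smul' r x := by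
    simp only [RingHom.id_apply, Algebra.mul_smul_comm, Algebra.smul_mul_assoc]

section

variable {F : Type*} [Field F] {c₁ c₂ : F}

theorem quatNorm_eq (x : ℍ[F, c₁, c₂]) :
    quatNorm x = x.re ^ 2 - c₁ * x.imI ^ 2 - c₂ * x.imJ ^ 2 + c₁ * c₂ * x.imK ^ 2 := by
  simp only [quatNorm, QuaternionAlgebra.re_mul, QuaternionAlgebra.re_star,
    QuaternionAlgebra.imI_star, QuaternionAlgebra.imJ_star, QuaternionAlgebra.imK_star]
  ring

theorem quatNorm_mul (x y : ℍ[F, c₁, c₂]) : quatNorm (x * y) = quatNorm x * quatNorm y := by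
  simp only [quatNorm_eq, QuaternionAlgebra.re_mul, QuaternionAlgebra.imI_mul,
    QuaternionAlgebra.imJ_mul, QuaternionAlgebra.imK_mul]
  ring

theorem quatNorm_star (x : ℍ[F, c₁, c₂]) : quatNorm (star x) = quatNorm x := by
  simp [quatNorm_eq]

theorem det_mulLeft_quaternionAlgebra (a : ℍ[F, c₁, c₂]) :
    LinearMap.det (LinearMap.mulLeft F a) = quatNorm a ^ 2 := by
  rw [← LinearMap.det_toMatrix (QuaternionAlgebra.basisOneIJK c₁ 0 c₂), quatNorm_eq]
  have h : LinearMap.toMatrix (QuaternionAlgebra.basisOneIJK c₁ 0 c₂)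
      (QuaternionAlgebra.basisOneIJK c₁ 0 c₂) (LinearMap.mulLeft F a) =
      !![a.re, c₁ * a.imI, c₂ * a.imJ, -(c₁ * c₂ * a.imK);
         a.imI, a.re, c₂ * a.imK, -(c₂ * a.imJ);
         a.imJ, -(c₁ * a.imK), a.re, c₁ * a.imI;
         a.imK, -a.imJ, a.imI, a.re] := by
    ext i j
    fin_cases i <;> fin_cases j <;>
      simp [LinearMap.toMatrix_apply, QuaternionAlgebra.basisOneIJK, mul_comm, mul_left_comm]
  rw [h]
  simp [Matrix.det_succ_row_zero, Fin.sum_univ_succ, Fin.succAbove]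
  ring

theorem det_mulRight_quaternionAlgebra (a : ℍ[F, c₁, c₂]) :
    LinearMap.det (LinearMap.mulRight F a) = quatNorm a ^ 2 := by
  rw [← LinearMap.det_toMatrix (QuaternionAlgebra.basisOneIJK c₁ 0 c₂), quatNorm_eq]
  have h : LinearMap.toMatrix (QuaternionAlgebra.basisOneIJK c₁ 0 c₂)
      (QuaternionAlgebra.basisOneIJK c₁ 0 c₂) (LinearMap.mulRight F a) =
      !![a.re, c₁ * a.imI, c₂ * a.imJ, -(c₁ * c₂ * a.imK);
         a.imI, a.re, -(c₂ * a.imK), c₂ * a.imJ;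
         a.imJ, c₁ * a.imK, a.re, -(c₁ * a.imI);
         a.imK, a.imJ, -a.imI, a.re] := by
    ext i j
    fin_cases i <;> fin_cases j <;>
      simp [LinearMap.toMatrix_apply, QuaternionAlgebra.basisOneIJK, mul_comm, mul_left_comm]
  rw [h]
  simp [Matrix.det_succ_row_zero, Fin.sum_univ_succ, Fin.succAbove]
  ring

theorem rhoLinear_eq_comp (α β : ℍ[F, c₁, c₂]) :
    rhoLinear α β = LinearMap.mulRight F (star β) ∘ₗ LinearMap.mulLeft F α :=
  rfl

end

/-- for units `α, β` of `D = ℍ[F,c₁,c₂]`, the map `ρ_{α,β} : x ↦ α x β̄` is an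
`F`-linear automorphism of `D` with `N(ρ_{α,β} x) = N(α) N(β) N(x)` and determinant
`(N(α) N(β))²`; i.e. it is a similitude of `(D, N)` with factor `λ = N(α)N(β)` and
determinant `λ²`, hence lies in `GSO(D, N)`. -/
theorem rho_is_special_similitude
    (F : Type*) [Field F] (hF : (2 : F) ≠ 0) (c₁ c₂ : F) (hc₁ : c₁ ≠ 0) (hc₂ : c₂ ≠ 0)
    (α β : (ℍ[F, c₁, c₂])ˣ) :
    Function.Bijective (rhoLinear (α : ℍ[F, c₁, c₂]) (β : ℍ[F, c₁, c₂])) ∧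
    (∀ x : ℍ[F, c₁, c₂],
      quatNorm (rhoLinear (α : ℍ[F, c₁, c₂]) (β : ℍ[F, c₁, c₂]) x)
        = quatNorm (α : ℍ[F, c₁, c₂]) * quatNorm (β : ℍ[F, c₁, c₂]) * quatNorm x) ∧
    LinearMap.det (rhoLinear (α : ℍ[F, c₁, c₂]) (β : ℍ[F, c₁, c₂]))
      = (quatNorm (α : ℍ[F, c₁, c₂]) * quatNorm (β : ℍ[F, c₁, c₂])) ^ 2 := by
  refine ⟨?_, fun x => ?_, ?_⟩
  · exact ((star β).mulRight_bijective).comp α.mulLeft_bijective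
  · change quatNorm ((α : ℍ[F, c₁, c₂]) * x * star (β : ℍ[F, c₁, c₂])) = _
    rw [quatNorm_mul, quatNorm_mul, quatNorm_star]
    ring
  · rw [rhoLinear_eq_comp, LinearMap.det_comp, det_mulLeft_quaternionAlgebra,
      det_mulRight_quaternionAlgebra, quatNorm_star]
    ring
end

section
/- Let F be a field with char F ≠ 2 and D a quaternion algebra over F. Let V_D ⊆ M₂(D) be the set of 2×2 Hermitian matrices over D, i.e. matrices of the form X = [[a·1, x], [x̄, d·1]] with a, d ∈ F and x ∈ D. Then V_D is a 6-dimensional F-subspace of M₂(D), the map q_D(X) = −a·d + N(x) is a nondegenerate quadratic form on V_D, and the quadratic space (V_D, q_D) is isometric to the orthogonal direct sum (D, N) ⊥ ℍ of the norm form of D and a hyperbolic plane. -/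
open Quaternion

/-- The space `V_D` of `2×2` Hermitian matrices over `D = ℍ[F,c₁,c₂]`: matrices
`[[a·1, x], [x̄, d·1]]` with `a, d ∈ F`, `x ∈ D`, as an `F`-submodule of `M₂(D)`. -/
def hermitianSub (F : Type*) [Field F] (c₁ c₂ : F) :
    Submodule F (Matrix (Fin 2) (Fin 2) ℍ[F, c₁, c₂]) where
  carrier := {X | (∃ a : F, X 0 0 = algebraMap F ℍ[F, c₁, c₂] a) ∧
    (∃ d : F, X 1 1 = algebraMap F ℍ[F, c₁, c₂] d) ∧ X 1 0 = star (X 0 1)}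
  add_mem' := by
    rintro X Y ⟨⟨a, ha⟩, ⟨d, hd⟩, hx⟩ ⟨⟨a', ha'⟩, ⟨d', hd'⟩, hx'⟩
    refine ⟨⟨a + a', ?_⟩, ⟨d + d', ?_⟩, ?_⟩ <;>
      simp [Matrix.add_apply, ha, ha', hd, hd', hx, hx', map_add, star_add]
  zero_mem' := ⟨⟨0, by simp⟩, ⟨0, by simp⟩, by simp⟩
  smul_mem' := by
    rintro c X ⟨⟨a, ha⟩, ⟨d, hd⟩, hx⟩
    refine ⟨⟨c * a, ?_⟩, ⟨c * d, ?_⟩, ?_⟩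
    · rw [Matrix.smul_apply, ha, Algebra.smul_def, ← map_mul]
    · rw [Matrix.smul_apply, hd, Algebra.smul_def, ← map_mul]
    · rw [Matrix.smul_apply, Matrix.smul_apply, hx, QuaternionAlgebra.star_smul]

/-- The quadratic form `q_D(X) = -a·d + N(x)` on the Hermitian matrices
`X = [[a·1, x], [x̄, d·1]]`. -/
noncomputable def qD (F : Type*) [Field F] (c₁ c₂ : F) :
    QuadraticForm F (hermitianSub F c₁ c₂) where
  toFun X := -(((X : Matrix (Fin 2) (Fin 2) ℍ[F, c₁, c₂]) 0 0).re *
      ((X : Matrix (Fin 2) (Fin 2) ℍ[F, c₁, c₂]) 1 1).re) +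
    quatNorm ((X : Matrix (Fin 2) (Fin 2) ℍ[F, c₁, c₂]) 0 1)
  toFun_smul := by
    intro a X
    simp [quatNorm, Matrix.smul_apply, QuaternionAlgebra.star_smul, Algebra.mul_smul_comm,
      Algebra.smul_mul_assoc, smul_smul, smul_eq_mul]
    ring
  exists_companion' := by
    refine ⟨LinearMap.mk₂ F (fun X Y =>
      -(((X : Matrix (Fin 2) (Fin 2) ℍ[F, c₁, c₂]) 0 0).re *
          ((Y : Matrix (Fin 2) (Fin 2) ℍ[F, c₁, c₂]) 1 1).re)
      - (((Y : Matrix (Fin 2) (Fin 2) ℍ[F, c₁, c₂]) 0 0).re *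
          ((X : Matrix (Fin 2) (Fin 2) ℍ[F, c₁, c₂]) 1 1).re)
      + ((X : Matrix (Fin 2) (Fin 2) ℍ[F, c₁, c₂]) 0 1 *
            star ((Y : Matrix (Fin 2) (Fin 2) ℍ[F, c₁, c₂]) 0 1) +
          (Y : Matrix (Fin 2) (Fin 2) ℍ[F, c₁, c₂]) 0 1 *
            star ((X : Matrix (Fin 2) (Fin 2) ℍ[F, c₁, c₂]) 0 1)).re) ?_ ?_ ?_ ?_, ?_⟩ <;>
      intros <;>
      simp [quatNorm, Matrix.add_apply, Matrix.smul_apply, star_add,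
        QuaternionAlgebra.star_smul, mul_add, add_mul, Algebra.mul_smul_comm,
        Algebra.smul_mul_assoc, smul_eq_mul] <;> ring

/-- The reduced norm as a quadratic form on `D = ℍ[F,c₁,c₂]`. -/
noncomputable def quatNormForm (F : Type*) [Field F] (c₁ c₂ : F) :
    QuadraticForm F ℍ[F, c₁, c₂] where
  toFun := quatNorm
  toFun_smul := by
    intro a x
    simp [quatNorm, QuaternionAlgebra.star_smul, Algebra.mul_smul_comm,
      Algebra.smul_mul_assoc, smul_smul, smul_eq_mul]
  exists_companion' := by
    refine ⟨LinearMap.mk₂ F (fun x y => (x * star y + y * star x).re) ?_ ?_ ?_ ?_, ?_⟩ <;>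
      intros <;>
      simp [quatNorm, star_add, QuaternionAlgebra.star_smul, mul_add, add_mul,
        Algebra.mul_smul_comm, Algebra.smul_mul_assoc, smul_eq_mul] <;> ring

/-- The hyperbolic plane: `F²` with the quadratic form `(u, v) ↦ u·v`. -/
noncomputable def hypPlane (F : Type*) [Field F] : QuadraticForm F (F × F) where
  toFun p := p.1 * p.2
  toFun_smul := by intro a p; simp [smul_eq_mul]; ring
  exists_companion' := by
    refine ⟨LinearMap.mk₂ F (fun p q => p.1 * q.2 + q.1 * p.2) ?_ ?_ ?_ ?_, ?_⟩ <;>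
      intros <;> simp [smul_eq_mul] <;> ring

/-- The coordinates `X ↦ (x, (-a, d))` of a Hermitian matrix `X = [[a·1, x], [x̄, d·1]]`. -/
noncomputable def hermitianSubEquiv (F : Type*) [Field F] (c₁ c₂ : F) :
    hermitianSub F c₁ c₂ ≃ₗ[F] ℍ[F, c₁, c₂] × (F × F) where
  toFun X := ((X : Matrix (Fin 2) (Fin 2) ℍ[F, c₁, c₂]) 0 1,
    (-((X : Matrix (Fin 2) (Fin 2) ℍ[F, c₁, c₂]) 0 0).re,
      ((X : Matrix (Fin 2) (Fin 2) ℍ[F, c₁, c₂]) 1 1).re))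
  map_add' X Y := by ext <;> simp [add_comm]
  map_smul' a X := by ext <;> simp
  invFun p := ⟨!![algebraMap F _ (-p.2.1), p.1; star p.1, algebraMap F _ p.2.2],
    ⟨-p.2.1, by simp⟩, ⟨p.2.2, by simp⟩, by simp⟩
  left_inv := by
    rintro ⟨X, ⟨a, ha⟩, ⟨d, hd⟩, hx⟩
    refine Subtype.ext (Matrix.ext fun i j => ?_)
    fin_cases i <;> fin_cases j <;> simp [ha, hd, hx]
  right_inv p := by simp

theorem prod_hermitianSubEquiv_apply {F : Type*} [Field F] {c₁ c₂ : F}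
    (X : hermitianSub F c₁ c₂) :
    (quatNormForm F c₁ c₂).prod (hypPlane F) (hermitianSubEquiv F c₁ c₂ X) = qD F c₁ c₂ X := by
  simp only [QuadraticMap.prod_apply, hermitianSubEquiv, quatNormForm, hypPlane, qD,
    QuadraticMap.coe_mk, LinearEquiv.coe_mk, LinearMap.coe_mk, AddHom.coe_mk]
  ring

theorem quatNormForm_apply {F : Type*} [Field F] {c₁ c₂ : F} (x : ℍ[F, c₁, c₂]) :
    quatNormForm F c₁ c₂ x =
      x.re ^ 2 - c₁ * x.imI ^ 2 - c₂ * x.imJ ^ 2 + c₁ * c₂ * x.imK ^ 2 := by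
  change (x * star x).re = _
  simp
  ring

theorem polar_quatNormForm {F : Type*} [Field F] {c₁ c₂ : F} (x y : ℍ[F, c₁, c₂]) :
    QuadraticMap.polar (quatNormForm F c₁ c₂) x y =
      2 * (x.re * y.re - c₁ * (x.imI * y.imI) - c₂ * (x.imJ * y.imJ) +
        c₁ * c₂ * (x.imK * y.imK)) := by
  simp only [QuadraticMap.polar, quatNormForm_apply, QuaternionAlgebra.re_add,
    QuaternionAlgebra.imI_add, QuaternionAlgebra.imJ_add, QuaternionAlgebra.imK_add]
  ring

theorem polar_hypPlane {F : Type*} [Field F] (p q : F × F) :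
    QuadraticMap.polar (hypPlane F) p q = p.1 * q.2 + p.2 * q.1 := by
  change (p + q).1 * (p + q).2 - p.1 * p.2 - q.1 * q.2 = _
  simp only [Prod.fst_add, Prod.snd_add]
  ring

theorem eq_zero_of_polar_quatNormForm {F : Type*} [Field F] (hF : (2 : F) ≠ 0) {c₁ c₂ : F}
    (hc₁ : c₁ ≠ 0) (hc₂ : c₂ ≠ 0) {x : ℍ[F, c₁, c₂]}
    (h : ∀ y, QuadraticMap.polar (quatNormForm F c₁ c₂) x y = 0) : x = 0 := by
  simp only [polar_quatNormForm] at h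
  ext
  · simpa [hF] using h ⟨1, 0, 0, 0⟩
  · simpa [hF, hc₁] using h ⟨0, 1, 0, 0⟩
  · simpa [hF, hc₂] using h ⟨0, 0, 1, 0⟩
  · simpa [hF, hc₁, hc₂] using h ⟨0, 0, 0, 1⟩

theorem eq_zero_of_polar_hypPlane {F : Type*} [Field F] {p : F × F}
    (h : ∀ q, QuadraticMap.polar (hypPlane F) p q = 0) : p = 0 := by
  simp only [polar_hypPlane] at h
  ext
  · simpa using h (0, 1)
  · simpa using h (1, 0)

theorem nondegenerate_polarBilin_qD {F : Type*} [Field F] (hF : (2 : F) ≠ 0) {c₁ c₂ : F}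
    (hc₁ : c₁ ≠ 0) (hc₂ : c₂ ≠ 0) :
    LinearMap.BilinForm.Nondegenerate (QuadraticMap.polarBilin (qD F c₁ c₂)) := by
  have hrefl : (QuadraticMap.polarBilin (qD F c₁ c₂)).IsRefl :=
    fun X Y => (QuadraticMap.polar_comm (qD F c₁ c₂) Y X).trans
  rw [LinearMap.BilinForm.Nondegenerate, hrefl.nondegenerate_iff_separatingLeft]
  intro X hX
  have key : ∀ q, QuadraticMap.polar ((quatNormForm F c₁ c₂).prod (hypPlane F))
      (hermitianSubEquiv F c₁ c₂ X) q = 0 := by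
    intro q
    obtain ⟨Y, rfl⟩ := (hermitianSubEquiv F c₁ c₂).surjective q
    have h := hX Y
    rw [QuadraticMap.polarBilin_apply_apply] at h
    simpa only [QuadraticMap.polar, ← map_add, prod_hermitianSubEquiv_apply] using h
  simp only [QuadraticMap.polar_prod] at key
  refine (hermitianSubEquiv F c₁ c₂).map_eq_zero_iff.mp (Prod.ext ?_ ?_)
  · exact eq_zero_of_polar_quatNormForm hF hc₁ hc₂ fun y => by simpa using key (y, 0)
  · exact eq_zero_of_polar_hypPlane fun q => by simpa using key (0, q)

/-- `V_D` is a 6-dimensional `F`-space, `q_D` is a nondegenerate quadratic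
form on it, and `(V_D, q_D)` is isometric to the orthogonal direct sum `(D, N) ⊥ ℍ`. -/
theorem hermitian_space_eq_norm_form_plus_hyperbolic
    (F : Type*) [Field F] (hF : (2 : F) ≠ 0) (c₁ c₂ : F) (hc₁ : c₁ ≠ 0) (hc₂ : c₂ ≠ 0) :
    Module.finrank F (hermitianSub F c₁ c₂) = 6 ∧
    LinearMap.BilinForm.Nondegenerate (QuadraticMap.polarBilin (qD F c₁ c₂)) ∧
    QuadraticMap.Equivalent (qD F c₁ c₂)
      (QuadraticMap.prod (quatNormForm F c₁ c₂) (hypPlane F)) := by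
  refine ⟨?_, nondegenerate_polarBilin_qD hF hc₁ hc₂,
    ⟨{ hermitianSubEquiv F c₁ c₂ with map_app' := prod_hermitianSubEquiv_apply }⟩⟩
  rw [(hermitianSubEquiv F c₁ c₂).finrank_eq, Module.finrank_prod, Module.finrank_prod,
    QuaternionAlgebra.finrank_eq_four, Module.finrank_self]
end

section
/- Let F be a field with char F ≠ 2 and let D₀ = M₂(F) be the split quaternion algebra, with conjugation x̄ = (tr x)·1₂ − x (the adjugate of x) and norm N(x) = det x. Identify M₂(D₀) with M₄(F) via 2×2 block matrices, and for g = (g_{ij}) ∈ M₂(D₀) set g* = (ḡ_{ji}). Let V = {[[a·1₂, x], [x̄, d·1₂]] : a, d ∈ F, x ∈ M₂(F)} with quadratic form q([[a·1₂, x], [x̄, d·1₂]]) = −a·d + det x. Then for every g ∈ M₄(F), z ∈ F and X ∈ V, one has z·g·X·g* ∈ V and q(z·g·X·g*) = z²·det(g)·q(X), where det(g) is the determinant of g as a 4×4 matrix over F. In particular, for (g, z) ∈ GL₄(F) × F×, the map X ↦ z g X g* is a similitude of (V, q) with similitude factor det(g)·z². -/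
open Matrix

/-- The conjugation of the split quaternion algebra `M₂(F)`: `x̄ = (tr x)·1 - x`
(the adjugate of `x`), so that `x · x̄ = det(x)·1`. -/
def splitConj (F : Type*) [Field F] (x : Matrix (Fin 2) (Fin 2) F) :
    Matrix (Fin 2) (Fin 2) F :=
  x.trace • 1 - x

/-- The space `V` of Hermitian `2×2` matrices over the split quaternion algebra `M₂(F)`:
block matrices `[[a·1₂, x], [x̄, d·1₂]]` with `a, d ∈ F`, `x ∈ M₂(F)`. -/
def splitHermSet (F : Type*) [Field F] :
    Set (Matrix (Fin 2) (Fin 2) (Matrix (Fin 2) (Fin 2) F)) :=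
  {X | (∃ a : F, X 0 0 = a • 1) ∧ (∃ d : F, X 1 1 = d • 1) ∧ X 1 0 = splitConj F (X 0 1)}

/-- The quadratic form `q([[a·1₂, x], [x̄, d·1₂]]) = -a·d + det x` on `V` (the values
`a`, `d` are read off as the `(0,0)` entries of the diagonal blocks). -/
def splitQ (F : Type*) [Field F] (X : Matrix (Fin 2) (Fin 2) (Matrix (Fin 2) (Fin 2) F)) : F :=
  -((X 0 0) 0 0 * (X 1 1) 0 0) + (X 0 1).det

/-- The conjugate-transpose `g* = (ḡ_{ji})` of a `2×2` block matrix over `M₂(F)`. -/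
def splitConjTranspose (F : Type*) [Field F]
    (g : Matrix (Fin 2) (Fin 2) (Matrix (Fin 2) (Fin 2) F)) :
    Matrix (Fin 2) (Fin 2) (Matrix (Fin 2) (Fin 2) F) :=
  Matrix.of fun i j => splitConj F (g j i)

/-- The determinant of a `2 × 2` block matrix with `2 × 2` blocks, as that of a `Fin 4` matrix. -/
theorem det_compRingEquiv_fin_two {R : Type*} [CommRing R]
    (g : Matrix (Fin 2) (Fin 2) (Matrix (Fin 2) (Fin 2) R)) :
    (Matrix.compRingEquiv (Fin 2) (Fin 2) R g).det =
      (!![g 0 0 0 0, g 0 0 0 1, g 0 1 0 0, g 0 1 0 1;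
          g 0 0 1 0, g 0 0 1 1, g 0 1 1 0, g 0 1 1 1;
          g 1 0 0 0, g 1 0 0 1, g 1 1 0 0, g 1 1 0 1;
          g 1 0 1 0, g 1 0 1 1, g 1 1 1 0, g 1 1 1 1] : Matrix (Fin 4) (Fin 4) R).det := by
  rw [← Matrix.det_submatrix_equiv_self (finProdFinEquiv (m := 2) (n := 2)).symm]
  congr 1
  ext i j
  fin_cases i <;> fin_cases j <;> rfl

/-- The conjugate of a `2 × 2` matrix in coordinates. -/
theorem splitConj_eq (F : Type*) [Field F] (x : Matrix (Fin 2) (Fin 2) F) :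
    splitConj F x = !![x 1 1, -x 0 1; -x 1 0, x 0 0] := by
  ext i j
  fin_cases i <;> fin_cases j <;> simp [splitConj, Matrix.trace_fin_two]

/-- for every `g ∈ M₄(F)` (viewed as a `2×2` block matrix over `M₂(F)`),
`z ∈ F` and Hermitian `X ∈ V`, one has `z·g·X·g* ∈ V` and
`q(z·g·X·g*) = z²·det(g)·q(X)`, where `det(g)` is the determinant of `g` as a `4×4`
matrix over `F`. In particular, for `(g, z) ∈ GL₄(F) × F×`, `X ↦ z g X g*` is a
similitude of `(V, q)` with factor `det(g)·z²`. -/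
theorem split_hermitian_similitude
    (F : Type*) [Field F] (hF : (2 : F) ≠ 0) :
    ∀ (g : Matrix (Fin 2) (Fin 2) (Matrix (Fin 2) (Fin 2) F)) (z : F)
      (X : Matrix (Fin 2) (Fin 2) (Matrix (Fin 2) (Fin 2) F)), X ∈ splitHermSet F →
      z • (g * X * splitConjTranspose F g) ∈ splitHermSet F ∧
      splitQ F (z • (g * X * splitConjTranspose F g))
        = z ^ 2 * (Matrix.compRingEquiv (Fin 2) (Fin 2) F g).det * splitQ F X := by
  intro g z X ⟨⟨a, ha⟩, ⟨d, hd⟩, hX⟩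
  refine ⟨⟨⟨(z • (g * X * splitConjTranspose F g)) 0 0 0 0, ?_⟩,
    ⟨(z • (g * X * splitConjTranspose F g)) 1 1 0 0, ?_⟩, ?_⟩, ?_⟩
  rotate_right
  · rw [det_compRingEquiv_fin_two]
    simp [splitQ, Matrix.det_succ_row_zero, Fin.sum_univ_succ, Fin.succAbove,
      Matrix.mul_apply, splitConjTranspose, splitConj_eq, ha, hd, hX,
      Matrix.add_apply]
    ring
  all_goals
    ext i j
    fin_cases i <;> fin_cases j <;>
      simp [Matrix.mul_apply, Fin.sum_univ_two, splitConjTranspose, splitConj_eq, ha, hd, hX,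
        Matrix.add_apply, -mul_eq_mul_left_iff, -mul_eq_zero, -zero_eq_mul] <;> ring
end

section
/- Let F be a field, V a finite-dimensional F-vector space of dimension 2n equipped with a nondegenerate alternating bilinear form ω, and let g be an F-linear automorphism of V and λ ∈ F× with ω(g x, g y) = λ·ω(x, y) for all x, y ∈ V. Then det g = λⁿ. In particular, every symplectic similitude has determinant equal to the n-th power of its similitude factor. -/
open Matrix Module

namespace LinearMap.BilinForm

theorem linearIndependent_of_isUnit_det_gram {K V ι : Type*} [Field K] [AddCommGroup V]
    [Module K V] [Fintype ι] [DecidableEq ι] (B : LinearMap.BilinForm K V) (v : ι → V)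
    (h : IsUnit (Matrix.of fun i j => B (v i) (v j)).det) : LinearIndependent K v := by
  rw [Fintype.linearIndependent_iff]
  intro c hc
  have hzero : c ᵥ* (Matrix.of fun i j => B (v i) (v j)) = 0 := by
    ext j
    have := congrArg (fun x => B x (v j)) hc
    simpa [Matrix.vecMul, dotProduct] using this
  exact congrFun (Matrix.eq_zero_of_vecMul_eq_zero h.ne_zero hzero)

/-- A vector `e ≠ 0` extends to a hyperbolic pair, whose orthogonal complement has
codimension two and inherits a nondegenerate form. -/
theorem exists_hyperbolic_pair {K V : Type*} [Field K] [AddCommGroup V] [Module K V]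
    [FiniteDimensional K V] {B : LinearMap.BilinForm K V} (halt : B.IsAlt)
    (hnd : B.Nondegenerate) {e : V} (he : e ≠ 0) :
    ∃ (f : V) (W : Submodule K V), B e f = -1 ∧ (∀ w ∈ W, B e w = 0 ∧ B f w = 0) ∧
      finrank K W = finrank K V - 2 ∧ (B.restrict W).Nondegenerate := by
  obtain ⟨f₀, hf₀⟩ : ∃ f₀, B e f₀ ≠ 0 := by
    by_contra! h
    exact he (hnd.1 e h)
  obtain ⟨f, hef⟩ : ∃ f, B e f = -1 := ⟨-(B e f₀)⁻¹ • f₀, by simp [hf₀]⟩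
  have hfe : B f e = 1 := by rw [← halt.neg_eq e f, hef, neg_neg]
  have hee := halt.self_eq_zero e
  have hff := halt.self_eq_zero f
  have hli : LinearIndependent K ![e, f] :=
    linearIndependent_of_isUnit_det_gram B _ (by simp [Matrix.det_fin_two, hef, hfe, hee, hff])
  have hmem (w : V) :
      w ∈ B.orthogonal (Submodule.span K (Set.range ![e, f])) ↔ B e w = 0 ∧ B f w = 0 := by
    constructor
    · intro hw
      exact ⟨hw e (Submodule.subset_span ⟨0, rfl⟩), hw f (Submodule.subset_span ⟨1, rfl⟩)⟩
    · rintro ⟨h₁, h₂⟩ x hx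
      have hle : Submodule.span K (Set.range ![e, f]) ≤ LinearMap.ker (B.flip w) := by
        rw [Submodule.span_le]
        rintro _ ⟨i, rfl⟩
        fin_cases i <;> simpa
      simpa using hle hx
  refine ⟨f, _, hef, fun w hw => (hmem w).1 hw, ?_, ?_⟩
  · rw [finrank_orthogonal hnd, finrank_span_eq_card hli, Fintype.card_fin]
  · have hrefl : (B.restrict (B.orthogonal (Submodule.span K (Set.range ![e, f])))).IsRefl :=
      LinearMap.IsAlt.isRefl fun x => halt x
    refine hrefl.nondegenerate_iff_separatingLeft.2 ?_
    rintro ⟨x, hx⟩ h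
    obtain ⟨hex, hfx⟩ := (hmem x).1 hx
    have hxe : B x e = 0 := by rw [← halt.neg_eq, hex, neg_zero]
    have hxf : B x f = 0 := by rw [← halt.neg_eq, hfx, neg_zero]
    rw [Submodule.mk_eq_zero]
    refine hnd.1 x fun y => ?_
    have hy := h ⟨y - B f y • e + B e y • f, (hmem _).2 (by simp [hee, hff, hef, hfe])⟩
    simpa [hxe, hxf] using hy

theorem exists_symplectic_family {K : Type*} [Field K] (n : ℕ) {V : Type*} [AddCommGroup V]
    [Module K V] [FiniteDimensional K V] (hdim : finrank K V = 2 * n)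
    {B : LinearMap.BilinForm K V} (halt : B.IsAlt) (hnd : B.Nondegenerate) :
    ∃ v : Fin n ⊕ Fin n → V, ∀ i j, B (v i) (v j) = J (Fin n) K i j := by
  induction n generalizing V with
  | zero => exact ⟨fun _ => 0, fun i => by rcases i with i | i <;> exact i.elim0⟩
  | succ n ih =>
    have : Nontrivial V := Module.nontrivial_of_finrank_pos (R := K) (by omega)
    obtain ⟨e, he⟩ := exists_ne (0 : V)
    obtain ⟨f, W, hef, hW, hrank, hWnd⟩ := exists_hyperbolic_pair halt hnd he
    obtain ⟨v, hv⟩ := ih (V := W) (by omega) (B := B.restrict W) (fun x => halt x) hWnd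
    have hv' (i j) : B (v i : V) (v j : V) = J (Fin n) K i j := hv i j
    have hfe : B f e = 1 := by rw [← halt.neg_eq e f, hef, neg_neg]
    have hew (w : W) : B e w = 0 := (hW w w.2).1
    have hfw (w : W) : B f w = 0 := (hW w w.2).2
    have hwe (w : W) : B w e = 0 := by rw [← halt.neg_eq, hew, neg_zero]
    have hwf (w : W) : B w f = 0 := by rw [← halt.neg_eq, hfw, neg_zero]
    refine ⟨Sum.elim (Fin.cons e fun i => (v (.inl i) : V))
      (Fin.cons f fun i => (v (.inr i) : V)), ?_⟩
    rintro (i | i) (j | j) <;> refine Fin.cases ?_ (fun i => ?_) i <;>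
      refine Fin.cases ?_ (fun j => ?_) j <;>
      simp [J, Matrix.one_apply, hef, hfe, hew, hfw, hwe, hwf, hv', halt.self_eq_zero,
        (Fin.succ_ne_zero _).symm]

theorem exists_symplectic_basis {K V : Type*} [Field K] [AddCommGroup V] [Module K V]
    [FiniteDimensional K V] {n : ℕ} (hdim : finrank K V = 2 * n)
    {B : LinearMap.BilinForm K V} (halt : B.IsAlt) (hnd : B.Nondegenerate) :
    ∃ b : Basis (Fin n ⊕ Fin n) K V, BilinForm.toMatrix b B = J (Fin n) K := by
  obtain ⟨v, hv⟩ := exists_symplectic_family n hdim halt hnd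
  have hgram : (Matrix.of fun i j => B (v i) (v j)) = J (Fin n) K := by
    ext i j
    exact hv i j
  have hli := linearIndependent_of_isUnit_det_gram B v (hgram ▸ isUnit_det_J (Fin n) K)
  refine ⟨basisOfLinearIndependentOfCardEqFinrank' v hli (by simp [hdim, two_mul]), ?_⟩
  ext i j
  simp [BilinForm.toMatrix_apply, hv]

end LinearMap.BilinForm

theorem Matrix.det_eq_pow_of_transpose_mul_J_mul {ι K : Type*} [Fintype ι] [DecidableEq ι]
    [Field K] {A : Matrix (ι ⊕ ι) (ι ⊕ ι) K} {c : K} (hc : c ≠ 0)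
    (hA : Aᵀ * J ι K * A = c • J ι K) : A.det = c ^ Fintype.card ι := by
  set D : Matrix (ι ⊕ ι) (ι ⊕ ι) K := fromBlocks 1 0 0 (c⁻¹ • 1) with hD
  have hmem : A * D ∈ symplecticGroup ι K := by
    rw [SymplecticGroup.mem_iff']
    calc (A * D)ᵀ * J ι K * (A * D) = Dᵀ * (Aᵀ * J ι K * A) * D := by
          simp only [transpose_mul, Matrix.mul_assoc]
      _ = J ι K := by
          rw [hA, hD, J]
          simp [fromBlocks_transpose, fromBlocks_smul, fromBlocks_multiply, smul_smul, hc]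
  have hdet := SymplecticGroup.det_eq_one hmem
  rw [det_mul, hD, det_fromBlocks_zero₂₁, det_one, one_mul, det_smul, det_one, mul_one,
    inv_pow] at hdet
  exact (mul_inv_eq_one₀ (pow_ne_zero _ hc)).1 hdet

/-- a symplectic similitude `g` with factor `λ` of a nondegenerate
alternating bilinear space of dimension `2n` has determinant `λⁿ`. -/
theorem symplectic_similitude_det
    (F : Type*) [Field F]
    (V : Type*) [AddCommGroup V] [Module F V] [FiniteDimensional F V]
    (n : ℕ) (hdim : Module.finrank F V = 2 * n)
    (ω : LinearMap.BilinForm F V) (halt : ∀ x, ω x x = 0)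
    (hnd : LinearMap.BilinForm.Nondegenerate ω)
    (g : V ≃ₗ[F] V) (l : F) (hl : l ≠ 0)
    (hsim : ∀ x y, ω (g x) (g y) = l * ω x y) :
    LinearMap.det (g : V →ₗ[F] V) = l ^ n := by
  obtain ⟨b, hb⟩ := LinearMap.BilinForm.exists_symplectic_basis hdim halt hnd
  have hcomp : ω.comp (g : V →ₗ[F] V) (g : V →ₗ[F] V) = l • ω := by
    ext x y
    simpa using hsim x y
  have hmat := LinearMap.BilinForm.toMatrix_comp b b ω (g : V →ₗ[F] V) (g : V →ₗ[F] V)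
  rw [hcomp, map_smul, hb] at hmat
  rw [← LinearMap.det_toMatrix b, Matrix.det_eq_pow_of_transpose_mul_J_mul hl hmat.symm,
    Fintype.card_fin]
end
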